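/- Let n ≥ 2 and let p_1, …, p_n be integers with 2 ≤ p_1 ≤ ⋯ ≤ p_n, and set q = p_1⋯p_n − (p_1 + ⋯ + p_n) + n. If p_{n+1} is an integer with q ≤ p_{n+1} ≤ p_1⋯p_n, then p_{n+1} is a typical rank of format (p_1, …, p_{n+1}) over ℝ, and moreover every typical rank r of format (p_1, …, p_{n+1}) satisfies r ≥ p_{n+1}; that is, p_{n+1} is the smallest typical rank of p_1 × ⋯ × p_{n+1} tensors. -/

import Mathlib

open MeasureTheory

noncomputable section

/-- The rank-one tensor `a₁ ⊗ ⋯ ⊗ aₙ`. -/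
def rankOneTensor {n : ℕ} (p : Fin n → ℕ) (a : ∀ i, Fin (p i) → ℝ) :
    (∀ i, Fin (p i)) → ℝ :=
  fun k => ∏ i, a i (k i)

/-- The rank of a tensor: the least `r` such that `T` is a sum of `r` rank-one tensors. -/
def tensorRank {n : ℕ} (p : Fin n → ℕ) (T : (∀ i, Fin (p i)) → ℝ) : ℕ :=
  sInf {r | ∃ a : Fin r → ∀ i, Fin (p i) → ℝ, T = ∑ h, rankOneTensor p (a h)}

/-- `r` is a typical rank of format `p` over `ℝ`: the set of tensors of rank exactly `r`
has positive Lebesgue measure. -/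
def IsTypicalRank {n : ℕ} (p : Fin n → ℕ) (r : ℕ) : Prop :=
  0 < volume {T : (∀ i, Fin (p i)) → ℝ | tensorRank p T = r}

section ProductTensors

variable {ι : Type*} [Fintype ι] {α : ι → Type*} {R S : Type*}
  [CommRing R] [CommRing S]

/-- The rank-one tensor with factors `a i`, over an arbitrary index type and ring. -/
def productTensor (a : ∀ i, α i → R) : (∀ i, α i) → R :=
  fun k => ∏ i, a i (k i)

theorem map_productTensor (f : R →+* S) (a : ∀ i, α i → R) (k : ∀ i, α i) :
    f (productTensor a k) = productTensor (fun i x => f (a i x)) k := by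
  simp [productTensor]

theorem productTensor_single [∀ i, DecidableEq (α i)] (k : ∀ i, α i) :
    productTensor (fun i => (Pi.single (k i) 1 : α i → R)) = Pi.single k 1 := by
  ext l
  by_cases h : l = k
  · subst h; simp [productTensor]
  · obtain ⟨i, hi⟩ := Function.ne_iff.1 h
    rw [Pi.single_eq_of_ne h]
    exact Finset.prod_eq_zero (Finset.mem_univ i) (by simp [hi])

variable [DecidableEq ι]

theorem productTensor_add_single (a : ∀ i, α i → R) (i : ι) (v : α i → R) (t : R) :
    productTensor (a + t • (Pi.single i v : ∀ i, α i → R)) =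
      productTensor a + t • productTensor (Function.update a i v) := by
  ext k
  have hrest : ∀ b : ∀ i, α i → R, (∀ j ≠ i, b j = a j) →
      productTensor b k = b i (k i) * ∏ j ∈ Finset.univ.erase i, a j (k j) := by
    intro b hb
    rw [productTensor, ← Finset.mul_prod_erase _ _ (Finset.mem_univ i)]
    congr 1
    exact Finset.prod_congr rfl fun j hj => by rw [hb j (Finset.ne_of_mem_erase hj)]
  rw [Pi.add_apply, Pi.smul_apply, hrest a fun _ _ => rfl,
    hrest (Function.update a i v) fun j hj => Function.update_of_ne hj _ _,
    hrest (a + t • (Pi.single i v : ∀ i, α i → R)) fun j hj => by simp [hj]]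
  simp
  ring

/-- A row is either the rank-one tensor `A h`, or a tangent vector at `A j` obtained by replacing
one factor with the basis vector indexed by the row. -/
def tangentMatrix [∀ i, DecidableEq (α i)] {H : Type*} (j : H) (c : (∀ i, α i) → H ⊕ ι)
    (A : H → ∀ i, α i → R) : Matrix (∀ i, α i) (∀ i, α i) R :=
  fun k => Sum.elim (fun h => productTensor (A h))
    (fun i => productTensor (Function.update (A j) i (Pi.single (k i) 1))) (c k)

theorem tangentMatrix_map [∀ i, DecidableEq (α i)] {H : Type*} (f : R →+* S) (j : H)
    (c : (∀ i, α i) → H ⊕ ι) (A : H → ∀ i, α i → R) :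
    (tangentMatrix j c A).map f = tangentMatrix j c (fun h i x => f (A h i x)) := by
  ext k l
  rw [Matrix.map_apply]
  rcases hc : c k with h | i
  · simp [tangentMatrix, hc, map_productTensor]
  · simp only [tangentMatrix, hc, Sum.elim_inr, map_productTensor]
    congr 1
    ext i' x
    by_cases hi : i' = i
    · subst hi
      by_cases hx : x = k i'
      · subst hx; simp
      · simp [hx]
    · simp [hi]

/-- Multi-indices differing from `o` in at least two places, together with one extra point,
are no more numerous than the codimension of the Segre variety allows. -/
theorem exists_finset_card_add_one_le [Nonempty ι] [∀ i, Fintype (α i)] [∀ i, DecidableEq (α i)]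
    (o : ∀ i, α i) {N : ℕ} (hN : ∏ i, Fintype.card (α i) + Fintype.card ι ≤
      N + ∑ i, Fintype.card (α i)) :
    ∃ s : Finset (∀ i, α i), s.card + 1 ≤ N ∧
      ∀ k ∉ s, ∃ i, k = Function.update o i (k i) := by
  let f : Option (Σ i, {x : α i // x ≠ o i}) → ∀ i, α i :=
    fun y => y.elim o fun z => Function.update o z.1 z.2.1
  have hf : Function.Injective f := by
    rintro (_ | ⟨i, x, hx⟩) (_ | ⟨i', x', hx'⟩) h
    · rfl
    · have := congrFun h i'
      simp [f] at this
      exact absurd this.symm hx'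
    · have := congrFun h i
      simp [f] at this
      exact absurd this hx
    · have h1 : Function.update o i x = Function.update o i' x' := h
      have h2 := congrFun h1 i
      by_cases hi : i = i'
      · subst hi
        simp at h2
        subst h2
        rfl
      · simp [hi] at h2
        exact absurd h2 hx
  refine ⟨(Finset.univ.image f)ᶜ, ?_, ?_⟩
  · have hc := Finset.card_add_card_compl (Finset.univ.image f)
    rw [Finset.card_image_of_injective _ hf, Finset.card_univ, Fintype.card_option,
      Fintype.card_sigma, Fintype.card_pi] at hc
    have hs : ∑ i, Fintype.card {x : α i // x ≠ o i} + Fintype.card ι =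
        ∑ i, Fintype.card (α i) := by
      rw [Fintype.card_eq_sum_ones, ← Finset.sum_add_distrib]
      refine Finset.sum_congr rfl fun i _ => ?_
      have := Fintype.card_pos_iff.2 ⟨o i⟩
      rw [Fintype.card_subtype_compl, Fintype.card_subtype_eq]
      omega
    omega
  · intro k hk
    simp only [Finset.mem_compl, Finset.mem_image, Finset.mem_univ, true_and, not_not] at hk
    obtain ⟨_ | ⟨i, x, hx⟩, rfl⟩ := hk
    · exact ⟨Classical.arbitrary ι, by simp [f]⟩
    · exact ⟨i, by simp [f]⟩

theorem exists_tangentMatrix_eq_one [Nonempty ι] [∀ i, Fintype (α i)] [∀ i, Nonempty (α i)]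
    [∀ i, DecidableEq (α i)] {N : ℕ}
    (hN : ∏ i, Fintype.card (α i) + Fintype.card ι ≤ N + ∑ i, Fintype.card (α i))
    (j : Fin N) :
    ∃ (c : (∀ i, α i) → Fin N ⊕ ι) (A : Fin N → ∀ i, α i → R), tangentMatrix j c A = 1 := by
  classical
  let o : ∀ i, α i := fun i => Classical.arbitrary _
  obtain ⟨s, hs, hso⟩ := exists_finset_card_add_one_le o hN
  have hcard : Fintype.card s ≤ Fintype.card {h : Fin N // h ≠ j} := by
    rw [Fintype.card_subtype_compl, Fintype.card_subtype_eq, Fintype.card_fin, Fintype.card_coe]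
    omega
  obtain ⟨σ⟩ := Function.Embedding.nonempty_of_card_le hcard
  choose! τ hτ using hso
  let κ : Fin N → ∀ i, α i := Function.extend (fun k => (σ k : Fin N)) (fun k => k.1) (fun _ => o)
  have hσ : Function.Injective fun k => (σ k : Fin N) := Subtype.val_injective.comp σ.injective
  have hκj : κ j = o := Function.extend_apply' _ _ _ fun ⟨k, hk⟩ => (σ k).2 hk
  refine ⟨fun k => if h : k ∈ s then Sum.inl (σ ⟨k, h⟩) else Sum.inr (τ k),
    fun h i => Pi.single (κ h i) 1, ?_⟩
  have key : ∀ k, tangentMatrix (R := R) j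
      (fun k => if h : k ∈ s then Sum.inl ((σ ⟨k, h⟩ : Fin N)) else Sum.inr (τ k))
      (fun h i => Pi.single (κ h i) 1) k = Pi.single k 1 := by
    intro k
    by_cases hk : k ∈ s
    · have : κ (σ ⟨k, hk⟩) = k := hσ.extend_apply _ _ ⟨k, hk⟩
      simp only [tangentMatrix, hk, dite_true, Sum.elim_inl, this]
      exact productTensor_single k
    · simp only [tangentMatrix, hk, dite_false, Sum.elim_inr, hκj]
      rw [← productTensor_single k]
      congr 1
      ext i x
      by_cases hi : i = τ k
      · subst hi; simp
      · rw [Function.update_of_ne hi, hτ k hk, Function.update_of_ne hi]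
  ext k l
  rw [key, Matrix.one_apply, Pi.single_apply]
  simp [eq_comm]

theorem exists_forall_det_tangentMatrix_ne_zero [Nonempty ι] [∀ i, Fintype (α i)]
    [∀ i, Nonempty (α i)] [∀ i, DecidableEq (α i)] {N : ℕ}
    (hN : ∏ i, Fintype.card (α i) + Fintype.card ι ≤ N + ∑ i, Fintype.card (α i)) :
    ∃ A : Fin N → ∀ i, α i → ℝ, ∀ j, ∃ c, (tangentMatrix j c A).det ≠ 0 := by
  choose c B hB using exists_tangentMatrix_eq_one (R := ℝ) hN
  let X : Fin N → ∀ i, α i → MvPolynomial (Fin N × Σ i, α i) ℝ :=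
    fun h i x => MvPolynomial.X (h, ⟨i, x⟩)
  have heval : ∀ (A : Fin N → ∀ i, α i → ℝ) (j : Fin N),
      MvPolynomial.eval (fun y => A y.1 y.2.1 y.2.2) (tangentMatrix j (c j) X).det =
        (tangentMatrix j (c j) A).det := by
    intro A j
    rw [RingHom.map_det, RingHom.mapMatrix_apply, tangentMatrix_map]
    simp [X]
  have hne : ∏ j, (tangentMatrix j (c j) X).det ≠ 0 := by
    refine Finset.prod_ne_zero_iff.2 fun j _ h => ?_
    have := heval (B j) j
    rw [h, hB] at this
    simp at this
  obtain ⟨x, hx⟩ : ∃ x, MvPolynomial.eval x (∏ j, (tangentMatrix j (c j) X).det) ≠ 0 := by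
    by_contra! h
    exact hne (MvPolynomial.funext fun x => by rw [h x, map_zero])
  rw [map_prod, Finset.prod_ne_zero_iff] at hx
  refine ⟨fun h i y => x (h, ⟨i, y⟩), fun j => ⟨c j, ?_⟩⟩
  rw [← heval]
  exact hx j (Finset.mem_univ j)

/-- Terracini-type genericity: some choice of `N` rank-one tensors spans, together with the
tangent space of the Segre variety at any one of them, the whole tensor space. -/
theorem exists_forall_eq_top_of_productTensor_mem [Nonempty ι] [∀ i, Fintype (α i)]
    [∀ i, Nonempty (α i)] {N : ℕ}
    (hN : ∏ i, Fintype.card (α i) + Fintype.card ι ≤ N + ∑ i, Fintype.card (α i)) :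
    ∃ A : Fin N → ∀ i, α i → ℝ, ∀ (j : Fin N) (W : Submodule ℝ ((∀ i, α i) → ℝ)),
      (∀ h, productTensor (A h) ∈ W) →
      (∀ i v, productTensor (Function.update (A j) i v) ∈ W) → W = ⊤ := by
  classical
  obtain ⟨A, hA⟩ := exists_forall_det_tangentMatrix_ne_zero hN
  refine ⟨A, fun j W hL hT => ?_⟩
  obtain ⟨c, hc⟩ := hA j
  refine eq_top_iff.2 fun v _ => ?_
  obtain ⟨w, rfl⟩ := Matrix.vecMul_surjective_iff_isUnit.2
    ((Matrix.isUnit_iff_isUnit_det _).2 hc.isUnit) v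
  simp only [Matrix.vecMul_eq_sum]
  refine W.sum_mem fun k _ => W.smul_mem _ ?_
  rcases h : c k with a | i
  · simpa [tangentMatrix, Matrix.row, h] using hL a
  · simpa [tangentMatrix, Matrix.row, h] using hT i (Pi.single (k i) 1)

end ProductTensors

section Tensors

variable {n : ℕ}

theorem rankOneTensor_succ {p : Fin (n + 1) → ℕ} (a : ∀ i, Fin (p i) → ℝ) (k : ∀ i, Fin (p i)) :
    rankOneTensor p a k =
      productTensor (fun i : Fin n => a i.castSucc) (Fin.init k) *
        a (Fin.last n) (k (Fin.last n)) := by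
  simp [rankOneTensor, productTensor, Fin.prod_univ_castSucc, Fin.init]

/-- The sum of `r` rank-one tensors. -/
def rankOneSum (p : Fin n → ℕ) (r : ℕ) (a : Fin r → ∀ i, Fin (p i) → ℝ) :
    (∀ i, Fin (p i)) → ℝ :=
  ∑ h, rankOneTensor p (a h)

theorem contDiff_rankOneSum (p : Fin n → ℕ) (r : ℕ) : ContDiff ℝ 1 (rankOneSum p r) := by
  refine contDiff_pi.2 fun k => ?_
  simp only [rankOneSum, Finset.sum_apply, rankOneTensor]
  refine ContDiff.sum fun h _ => contDiff_prod fun i _ => ?_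
  exact contDiff_pi.1 (contDiff_pi.1 (contDiff_pi.1 contDiff_id h) i) (k i)

theorem rankOneSum_add_single (p : Fin n → ℕ) {r : ℕ} (a : Fin r → ∀ i, Fin (p i) → ℝ)
    (h : Fin r) (i : Fin n) (v : Fin (p i) → ℝ) (t : ℝ) :
    rankOneSum p r
        (a + t • (Pi.single h (Pi.single i v) : Fin r → ∀ i, Fin (p i) → ℝ)) =
      rankOneSum p r a + t • rankOneTensor p (Function.update (a h) i v) := by
  simp only [rankOneSum]
  rw [← Finset.add_sum_erase _ _ (Finset.mem_univ h),
    ← Finset.add_sum_erase _ (fun h => rankOneTensor p (a h)) (Finset.mem_univ h)]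
  have h1 : rankOneTensor p
      ((a + t • (Pi.single h (Pi.single i v) : Fin r → ∀ i, Fin (p i) → ℝ)) h) =
      rankOneTensor p (a h) + t • rankOneTensor p (Function.update (a h) i v) := by
    simp only [Pi.add_apply, Pi.smul_apply, Pi.single_eq_same]
    exact productTensor_add_single (a h) i v t
  have h2 : ∀ h' ∈ Finset.univ.erase h,
      rankOneTensor p
      ((a + t • (Pi.single h (Pi.single i v) : Fin r → ∀ i, Fin (p i) → ℝ)) h') =
        rankOneTensor p (a h') := by
    intro h' hh
    simp [Finset.ne_of_mem_erase hh]
  rw [h1, Finset.sum_congr rfl h2]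
  abel

theorem rankOneTensor_update_mem_range_fderiv (p : Fin n → ℕ) {r : ℕ}
    (a : Fin r → ∀ i, Fin (p i) → ℝ) (h : Fin r) (i : Fin n) (v : Fin (p i) → ℝ) :
    rankOneTensor p (Function.update (a h) i v) ∈ (fderiv ℝ (rankOneSum p r) a).range := by
  refine ⟨Pi.single h (Pi.single i v), ?_⟩
  have hd := ((contDiff_rankOneSum p r).differentiable one_ne_zero a).hasFDerivAt.hasLineDerivAt
    (Pi.single h (Pi.single i v))
  simp only [HasLineDerivAt, rankOneSum_add_single] at hd
  have hd' := ((hasDerivAt_id (0 : ℝ)).smul_const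
    (rankOneTensor p (Function.update (a h) i v))).const_add (rankOneSum p r a)
  simpa using hd.unique hd'

theorem exists_eq_rankOneSum (p : Fin (n + 1) → ℕ) (T : (∀ i, Fin (p i)) → ℝ) :
    ∃ r a, T = rankOneSum p r a := by
  let e := Fintype.equivFin (∀ i, Fin (p i))
  let b : (∀ i, Fin (p i)) → ∀ i, Fin (p i) → ℝ :=
    fun k i x => (Pi.single (k i) 1 : Fin (p i) → ℝ) x * if i = Fin.last n then T k else 1
  have hb : ∀ k, rankOneTensor p (b k) = T k • Pi.single k 1 := by
    intro k
    ext l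
    simp only [rankOneTensor, b, Finset.prod_mul_distrib, Finset.prod_ite_eq', Finset.mem_univ,
      if_true, Pi.smul_apply, smul_eq_mul]
    rw [mul_comm, ← productTensor_single]
    rfl
  refine ⟨_, fun h => b (e.symm h), ?_⟩
  rw [rankOneSum, Equiv.sum_comp e.symm (fun k => rankOneTensor p (b k))]
  simp only [hb]
  exact pi_eq_sum_univ' T

theorem exists_eq_rankOneSum_tensorRank (p : Fin (n + 1) → ℕ)
    (T : (∀ i, Fin (p i)) → ℝ) : ∃ a, T = rankOneSum p (tensorRank p T) a :=
  Nat.sInf_mem (s := {r | ∃ a : Fin r → ∀ i, Fin (p i) → ℝ, T = ∑ h, rankOneTensor p (a h)})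
    (exists_eq_rankOneSum p T)

theorem tensorRank_rankOneSum_le (p : Fin n → ℕ) {r : ℕ} (a : Fin r → ∀ i, Fin (p i) → ℝ) :
    tensorRank p (rankOneSum p r a) ≤ r :=
  Nat.sInf_le ⟨a, rfl⟩

/-- The square submatrix of the flattening along the last factor with rows selected by `f`. -/
def lastMinor {p : Fin (n + 1) → ℕ} (f : Fin (p (Fin.last n)) → ∀ i : Fin n, Fin (p i.castSucc)) :
    ((∀ i, Fin (p i)) → ℝ) →ₗ[ℝ] Matrix (Fin (p (Fin.last n))) (Fin (p (Fin.last n))) ℝ where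
  toFun T := Matrix.of fun b c => T (Fin.snoc (α := fun i => Fin (p i)) (f b) c)
  map_add' _ _ := rfl
  map_smul' _ _ := rfl

theorem lastMinor_apply {p : Fin (n + 1) → ℕ}
    (f : Fin (p (Fin.last n)) → ∀ i : Fin n, Fin (p i.castSucc)) (T : (∀ i, Fin (p i)) → ℝ)
    (b c : Fin (p (Fin.last n))) :
    lastMinor f T b c = T (Fin.snoc (α := fun i => Fin (p i)) (f b) c) :=
  rfl

theorem det_lastMinor_rankOneSum {p : Fin (n + 1) → ℕ}
    (f : Fin (p (Fin.last n)) → ∀ i : Fin n, Fin (p i.castSucc)) {r : ℕ}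
    (hr : r < p (Fin.last n)) (a : Fin r → ∀ i, Fin (p i) → ℝ) :
    (lastMinor f (rankOneSum p r a)).det = 0 := by
  by_contra h
  let B : Matrix (Fin (p (Fin.last n))) (Fin r) ℝ :=
    Matrix.of fun b h => productTensor (fun i : Fin n => a h i.castSucc) (f b)
  let C : Matrix (Fin r) (Fin (p (Fin.last n))) ℝ := Matrix.of fun h c => a h (Fin.last n) c
  have hBC : lastMinor f (rankOneSum p r a) = B * C := by
    ext b c
    simp [lastMinor_apply, rankOneSum, Matrix.mul_apply, B, C, rankOneTensor_succ]
  have h1 := Matrix.rank_of_isUnit _ ((Matrix.isUnit_iff_isUnit_det _).2 (Ne.isUnit h))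
  have h2 := (Matrix.rank_mul_le_left B C).trans (Matrix.rank_le_width B)
  rw [hBC, Fintype.card_fin] at h1
  omega

theorem ae_det_lastMinor_ne_zero {p : Fin (n + 1) → ℕ}
    (f : Fin (p (Fin.last n)) → ∀ i : Fin n, Fin (p i.castSucc)) (hf : Function.Injective f) :
    ∀ᵐ T : (∀ i, Fin (p i)) → ℝ, (lastMinor f T).det ≠ 0 := by
  have hcont : Continuous fun T => (lastMinor f T).det :=
    (LinearMap.continuous_of_finiteDimensional (lastMinor f)).matrix_det
  let E : (∀ i, Fin (p i)) → ℝ := fun k => if Fin.init k = f (k (Fin.last n)) then 1 else 0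
  have hE : lastMinor f E = 1 := by
    ext b c
    simp [lastMinor_apply, E, Matrix.one_apply, hf.eq_iff]
  refine ae_mem_of_ae_add_linearMap_mem (LinearMap.toSpanSingleton ℝ _ E) volume volume
    (s := {T | (lastMinor f T).det ≠ 0}) (isOpen_ne.preimage hcont).measurableSet fun T => ?_
  have hroots : ((-lastMinor f T).charpoly.roots.toFinset : Set ℝ).Finite := Finset.finite_toSet _
  filter_upwards [hroots.countable.ae_notMem volume] with t ht h
  refine ht ?_
  rw [Finset.mem_coe, Multiset.mem_toFinset,
    Polynomial.mem_roots (Matrix.charpoly_monic _).ne_zero, Polynomial.IsRoot,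
    Matrix.eval_charpoly, ← h, map_add, LinearMap.toSpanSingleton_apply, map_smul, hE]
  congr 1
  rw [sub_neg_eq_add, add_comm, Matrix.scalar_apply, Matrix.smul_one_eq_diagonal]

theorem volume_tensorRank_lt (p : Fin (n + 1) → ℕ)
    (hp : p (Fin.last n) ≤ ∏ i : Fin n, p i.castSucc) :
    volume {T : (∀ i, Fin (p i)) → ℝ | tensorRank p T < p (Fin.last n)} = 0 := by
  obtain ⟨f⟩ : Nonempty (Fin (p (Fin.last n)) ↪ ∀ i : Fin n, Fin (p i.castSucc)) :=
    Function.Embedding.nonempty_of_card_le (by simpa using hp)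
  refine measure_mono_null (fun T hT => ?_) (ae_iff.1 (ae_det_lastMinor_ne_zero f f.injective))
  obtain ⟨a, ha⟩ := exists_eq_rankOneSum_tensorRank p T
  rw [Set.mem_ofPred_eq, not_not, ha]
  exact det_lastMinor_rankOneSum f hT a

/-- Put a tensor into the slice `b` along the last factor. -/
def lastSlice {p : Fin (n + 1) → ℕ} (b : Fin (p (Fin.last n))) :
    ((∀ i : Fin n, Fin (p i.castSucc)) → ℝ) →ₗ[ℝ] (∀ i, Fin (p i)) → ℝ where
  toFun v k := v (Fin.init k) * (Pi.single b 1 : Fin (p (Fin.last n)) → ℝ) (k (Fin.last n))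
  map_add' _ _ := by ext; simp [add_mul]
  map_smul' _ _ := by ext; simp [mul_assoc]

theorem sum_lastSlice {p : Fin (n + 1) → ℕ} (T : (∀ i, Fin (p i)) → ℝ) :
    ∑ b, lastSlice b (fun k => T (Fin.snoc (α := fun i => Fin (p i)) k b)) = T := by
  ext k
  simp [lastSlice, Pi.single_apply]

theorem exists_range_fderiv_rankOneSum_eq_top (p : Fin (n + 1) → ℕ) [NeZero n]
    (hpos : ∀ i : Fin n, p i.castSucc ≠ 0)
    (hq : ∏ i : Fin n, p i.castSucc + n ≤ p (Fin.last n) + ∑ i : Fin n, p i.castSucc) :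
    ∃ a, (fderiv ℝ (rankOneSum p (p (Fin.last n))) a).range = ⊤ := by
  have (i : Fin n) : NeZero (p i.castSucc) := ⟨hpos i⟩
  obtain ⟨A, hA⟩ := exists_forall_eq_top_of_productTensor_mem
    (α := fun i : Fin n => Fin (p i.castSucc)) (N := p (Fin.last n)) (by simpa using hq)
  let a : Fin (p (Fin.last n)) → ∀ i, Fin (p i) → ℝ := fun h =>
    Fin.snoc (α := fun i => Fin (p i) → ℝ) (A h) (Pi.single h 1)
  refine ⟨a, eq_top_iff.2 fun T _ => ?_⟩
  have hslice : ∀ b,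
      (fderiv ℝ (rankOneSum p (p (Fin.last n))) a).range.comap (lastSlice b) = ⊤ := by
    intro b
    refine hA b _ (fun h => ?_) fun i v => ?_
    · convert rankOneTensor_update_mem_range_fderiv p a h (Fin.last n) (Pi.single b 1) using 1
      rw [Submodule.mem_comap]
      congr! 1
      ext k
      simp [rankOneTensor_succ, lastSlice, a, (Fin.castSucc_lt_last _).ne]
    · convert rankOneTensor_update_mem_range_fderiv p a b i.castSucc v using 1
      rw [Submodule.mem_comap]
      congr! 1
      ext k
      simp only [rankOneTensor_succ, lastSlice, a, ← Fin.snoc_update]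
      simp
  rw [← sum_lastSlice T]
  exact Submodule.sum_mem _ fun b _ => (Submodule.eq_top_iff'.1 (hslice b) _ :)

theorem volume_tensorRank_le_pos (p : Fin (n + 1) → ℕ) [NeZero n]
    (hpos : ∀ i : Fin n, p i.castSucc ≠ 0)
    (hq : ∏ i : Fin n, p i.castSucc + n ≤ p (Fin.last n) + ∑ i : Fin n, p i.castSucc) :
    0 < volume {T : (∀ i, Fin (p i)) → ℝ | tensorRank p T ≤ p (Fin.last n)} := by
  obtain ⟨a, ha⟩ := exists_range_fderiv_rankOneSum_eq_top p hpos hq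
  have hs := ((contDiff_rankOneSum p (p (Fin.last n))).contDiffAt (x := a)).hasStrictFDerivAt
    one_ne_zero
  refine Measure.measure_pos_of_mem_nhds volume (x := rankOneSum p _ a) ?_
  rw [← hs.map_nhds_eq_of_surj ha, Filter.mem_map]
  exact Filter.univ_mem' fun b => tensorRank_rankOneSum_le p b

end Tensors

/-- If `q = p₁⋯pₙ − (p₁+⋯+pₙ) + n ≤ p_{n+1} ≤ p₁⋯pₙ`, then `p_{n+1}` is a typical rank of
format `(p₁,…,p_{n+1})` over `ℝ`, and it is the smallest typical rank. -/
theorem perfect_format_is_typical_and_smallest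
    {n : ℕ} (hn : 2 ≤ n) (p : Fin (n + 1) → ℕ)
    (hp2 : 2 ≤ p 0)
    (hmono : ∀ i j : Fin n, i ≤ j → p i.castSucc ≤ p j.castSucc)
    (hq : (∏ i : Fin n, (p i.castSucc : ℤ)) - (∑ i : Fin n, (p i.castSucc : ℤ)) + n
        ≤ (p (Fin.last n) : ℤ))
    (hub : (p (Fin.last n) : ℤ) ≤ ∏ i : Fin n, (p i.castSucc : ℤ)) :
    IsTypicalRank p (p (Fin.last n)) ∧
      ∀ r : ℕ, IsTypicalRank p r → p (Fin.last n) ≤ r := by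
  have : NeZero n := ⟨by omega⟩
  have hpos : ∀ i : Fin n, p i.castSucc ≠ 0 := fun i => by
    have h0 := hmono 0 i (Fin.zero_le i)
    rw [Fin.castSucc_zero'] at h0
    omega
  have hub' : p (Fin.last n) ≤ ∏ i : Fin n, p i.castSucc := by exact_mod_cast hub
  have hq' : ∏ i : Fin n, p i.castSucc + n ≤ p (Fin.last n) + ∑ i : Fin n, p i.castSucc := by
    zify
    linarith
  have hnull := volume_tensorRank_lt p hub'
  constructor
  · refine (volume_tensorRank_le_pos p hpos hq').trans_le ?_
    refine (measure_mono (t := {T | tensorRank p T = p (Fin.last n)} ∪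
      {T | tensorRank p T < p (Fin.last n)}) fun T hT => hT.eq_or_lt).trans ?_
    refine (measure_union_le _ _).trans ?_
    rw [hnull, add_zero]
  · intro r hr
    by_contra! h
    exact hr.ne' (measure_mono_null (fun T hT => (Set.mem_ofPred_eq ▸ hT :).trans_lt h) hnull)

end
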